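/- Let X be a median graph of dimension at most D and staircase length at most σ (D, σ natural numbers), let a group Γ act on X by graph automorphisms, let s be an H-segment of length l ≥ 1, let x ∈ V be a base vertex, and let n ≥ 1. Let κ : V^{n+1} → ℝ be bounded, Γ-invariant, satisfy δκ = 0, and be non-transverse to the orbit Γs. Then there exists a bounded Γ-invariant function β : Γ^{n+2} → ℝ such that δβ = (δ¹f̂_{s,x}) ∪ (o_x^*κ) as functions Γ^{n+3} → ℝ; that is, the cup product [δ¹f̂_{s,x}] ∪ o_x^*[κ] is trivial in degree-(n+2) bounded cohomology of the group Γ. -/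

import Mathlib

open scoped BigOperators

namespace MedianQM

variable {V : Type*}

/-- The interval `[x,y]`: vertices on geodesics from `x` to `y`. -/
def interval (X : SimpleGraph V) (x y : V) : Set V :=
  {m | X.dist x m + X.dist m y = X.dist x y}

/-- A median graph: connected, and any three vertices admit a unique median. -/
def IsMedianGraph (X : SimpleGraph V) : Prop :=
  X.Connected ∧ ∀ x y z : V, ∃! m : V,
    m ∈ interval X x y ∧ m ∈ interval X y z ∧ m ∈ interval X x z

/-- A halfspace of `X`: the set of vertices strictly closer to one endpoint of
an edge than to the other. -/
def IsHalfspace (X : SimpleGraph V) (h : Set V) : Prop :=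
  ∃ a b : V, X.Adj a b ∧ h = {v | X.dist v a < X.dist v b}

/-- The edge `{a,b}` is dual to the halfspace `h` (equivalently, to the
hyperplane `{h, h̄}`). -/
def EdgeDual (X : SimpleGraph V) (h : Set V) (a b : V) : Prop :=
  X.Adj a b ∧
    (h = {v | X.dist v a < X.dist v b} ∨ h = {v | X.dist v b < X.dist v a})

/-- Two halfspaces are transverse. -/
def Transv (h k : Set V) : Prop :=
  (h ∩ k).Nonempty ∧ (hᶜ ∩ k).Nonempty ∧ (h ∩ kᶜ).Nonempty ∧ (hᶜ ∩ kᶜ).Nonempty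

/-- `[x,y]_H`: the set of halfspaces separating `y` from `x`. -/
def sepH (X : SimpleGraph V) (x y : V) : Set (Set V) :=
  {h | IsHalfspace X h ∧ y ∈ h ∧ x ∉ h}

/-- `X` has dimension at most `D`: every (finite) family of pairwise transverse
halfspaces has at most `D` elements. -/
def DimLE (X : SimpleGraph V) (D : ℕ) : Prop :=
  ∀ S : Finset (Set V), (∀ h ∈ S, IsHalfspace X h) →
    (∀ h ∈ S, ∀ k ∈ S, h ≠ k → Transv h k) → S.card ≤ D

/-- `h ⊋ k` are tightly nested: no halfspace lies strictly between them. -/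
def TightlyNested (X : SimpleGraph V) (h k : Set V) : Prop :=
  k ⊂ h ∧ ¬ ∃ h' : Set V, IsHalfspace X h' ∧ h' ⊂ h ∧ k ⊂ h'

/-- A staircase of length `n`. -/
def IsStaircase (X : SimpleGraph V) (n : ℕ) (h k : Fin n → Set V) : Prop :=
  (∀ i, IsHalfspace X (h i)) ∧ (∀ i, IsHalfspace X (k i)) ∧
  (∀ i j : Fin n, i < j → h j ⊂ h i) ∧ (∀ i j : Fin n, i < j → k j ⊂ k i) ∧
  (∀ i, k i ⊂ h i) ∧ (∀ i j : Fin n, j < i → Transv (h i) (k j))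

/-- `X` has staircase length at most `σ`: there is no staircase of length `σ+1`. -/
def StaircaseLE (X : SimpleGraph V) (σ : ℕ) : Prop :=
  ∀ h k : Fin (σ + 1) → Set V, ¬ IsStaircase X (σ + 1) h k

/-- An `H`-segment of length `l`: a tuple of consecutively tightly nested
halfspaces `h₁ ⊋ ⋯ ⊋ h_l`. -/
def IsHSegment (X : SimpleGraph V) (l : ℕ) (s : Fin l → Set V) : Prop :=
  (∀ i, IsHalfspace X (s i)) ∧
  ∀ i j : Fin l, (j : ℕ) = (i : ℕ) + 1 → TightlyNested X (s i) (s j)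

/-- The segment `t` is contained in `[x,y]_H`. -/
def SegIn (X : SimpleGraph V) (x y : V) {l : ℕ} (t : Fin l → Set V) : Prop :=
  ∀ i, t i ∈ sepH X x y

/-- The translate of a segment by a group element. -/
def segSMul {Γ : Type*} [SMul Γ V] (γ : Γ) {l : ℕ} (s : Fin l → Set V) :
    Fin l → Set V :=
  fun i => (γ • ·) '' s i

/-- The set of translates of `s` contained in `[x,y]_H`. -/
def translatesIn (X : SimpleGraph V) (Γ : Type*) [SMul Γ V] {l : ℕ}
    (s : Fin l → Set V) (x y : V) : Set (Fin l → Set V) :=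
  {t | (∃ γ : Γ, t = segSMul γ s) ∧ SegIn X x y t}

/-- The median quasimorphism of the segment `s` (for the action of `Γ` on `X`). -/
noncomputable def fs (X : SimpleGraph V) (Γ : Type*) [SMul Γ V] {l : ℕ}
    (s : Fin l → Set V) (x y : V) : ℝ :=
  ((translatesIn X Γ s x y).ncard : ℝ) - ((translatesIn X Γ s y x).ncard : ℝ)

/-- The coboundary of a function of two variables, evaluated on a triple. -/
noncomputable def d1 (f : V → V → ℝ) (x y z : V) : ℝ := f y z - f x z + f x y

/-- The simplicial coboundary operator. -/
noncomputable def cob {W : Type*} {m : ℕ} (β : (Fin (m + 1) → W) → ℝ) :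
    (Fin (m + 2) → W) → ℝ :=
  fun x => ∑ j : Fin (m + 2), (-1 : ℝ) ^ (j : ℕ) * β (fun i => x (j.succAbove i))

/-- Γ-invariance of a cochain. -/
def IsInvariant (Γ : Type*) {W : Type*} [SMul Γ W] {m : ℕ}
    (β : (Fin m → W) → ℝ) : Prop :=
  ∀ (γ : Γ) (x : Fin m → W), β (fun i => γ • x i) = β x

/-- Boundedness of a real-valued function. -/
def IsBounded {α : Type*} (β : α → ℝ) : Prop := ∃ C : ℝ, ∀ x, |β x| ≤ C

/-- A head of the segment `s`. -/
def IsHead (X : SimpleGraph V) {l : ℕ} (hl : 0 < l) (s : Fin l → Set V)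
    (a : V) : Prop :=
  a ∉ s ⟨0, hl⟩ ∧ ∃ b, EdgeDual X (s ⟨0, hl⟩) a b

/-- A tail of the segment `s`. -/
def IsTail (X : SimpleGraph V) {l : ℕ} (hl : 0 < l) (s : Fin l → Set V)
    (a : V) : Prop :=
  a ∈ s ⟨l - 1, by omega⟩ ∧ ∃ b, EdgeDual X (s ⟨l - 1, by omega⟩) a b

/-- The cochain `κ` is non-transverse to the segment `s`. -/
def NonTransverseTo (X : SimpleGraph V) {n l : ℕ} (hl : 0 < l)
    (κ : (Fin (n + 1) → V) → ℝ) (s : Fin l → Set V) : Prop :=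
  (∀ (x : Fin n → V) (a a' : V), IsHead X hl s a → IsHead X hl s a' →
    κ (Fin.cons a x) = κ (Fin.cons a' x)) ∧
  (∀ (x : Fin n → V) (a a' : V), IsTail X hl s a → IsTail X hl s a' →
    κ (Fin.cons a x) = κ (Fin.cons a' x))

/-- The action of `Γ` on `X` is by graph automorphisms. -/
def ActsOn (Γ : Type*) [SMul Γ V] (X : SimpleGraph V) : Prop :=
  ∀ (γ : Γ) (a b : V), X.Adj a b → X.Adj (γ • a) (γ • b)

/-! ### Halfspaces of median graphs -/

namespace IsMedianGraph

variable {X : SimpleGraph V}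

theorem dist_ne_of_adj (hX : IsMedianGraph X) {a b : V} (hab : X.Adj a b) (v : V) :
    X.dist v a ≠ X.dist v b := by
  obtain ⟨m, ⟨h₁, h₂, h₃⟩, -⟩ := hX.2 v a b
  simp only [interval, Set.mem_ofPred_eq] at h₁ h₂ h₃
  have := SimpleGraph.dist_eq_one_iff_adj.2 hab
  rw [X.dist_comm (u := a) (v := m)] at h₂
  omega

theorem dist_lt_or_dist_lt (hX : IsMedianGraph X) {a b : V} (hab : X.Adj a b) (v : V) :
    (X.dist v a < X.dist v b ∧ X.dist v b = X.dist v a + 1) ∨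
      (X.dist v b < X.dist v a ∧ X.dist v a = X.dist v b + 1) := by
  have h₁ := hX.dist_ne_of_adj hab v
  have h₂ := hX.1.dist_triangle (u := v) (v := a) (w := b)
  have h₃ := hX.1.dist_triangle (u := v) (v := b) (w := a)
  have h₄ := SimpleGraph.dist_eq_one_iff_adj.2 hab
  rw [X.dist_comm (u := b) (v := a)] at h₃
  omega

/-- A geodesic cannot leave a halfspace and come back. -/
theorem not_reenter (hX : IsMedianGraph X) {a b p q p' q' : V} (hab : X.Adj a b)
    (hpq : X.Adj p q) (hpq' : X.Adj p' q')
    (hp : X.dist p a < X.dist p b) (hp' : X.dist p' a < X.dist p' b)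
    (hq : X.dist q b < X.dist q a) (hq' : X.dist q' b < X.dist q' a)
    (hd : X.dist p p' = X.dist q q' + 2) : False := by
  have tri := fun u v w => hX.1.dist_triangle (u := u) (v := v) (w := w)
  have comm := fun u v => X.dist_comm (u := u) (v := v)
  obtain ⟨m, ⟨hm₁, hm₂, hm₃⟩, -⟩ := hX.2 p p' a
  obtain ⟨m', ⟨hm₁', hm₂', hm₃'⟩, -⟩ := hX.2 q q' b
  simp only [interval, Set.mem_ofPred_eq] at hm₁ hm₂ hm₃ hm₁' hm₂' hm₃'
  have e₁ := SimpleGraph.dist_eq_one_iff_adj.2 hpq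
  have e₂ := SimpleGraph.dist_eq_one_iff_adj.2 hpq'
  have e₃ := SimpleGraph.dist_eq_one_iff_adj.2 hab
  have f₁ := hX.dist_lt_or_dist_lt hab p
  have f₂ := hX.dist_lt_or_dist_lt hab p'
  have f₃ := hX.dist_lt_or_dist_lt hab q
  have f₄ := hX.dist_lt_or_dist_lt hab q'
  have f₅ := hX.dist_lt_or_dist_lt hpq a
  have f₆ := hX.dist_lt_or_dist_lt hpq b
  have f₇ := hX.dist_lt_or_dist_lt hpq' a
  have f₈ := hX.dist_lt_or_dist_lt hpq' b
  rw [comm a p, comm a q] at f₅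
  rw [comm b p, comm b q] at f₆
  rw [comm a p', comm a q'] at f₇
  rw [comm b p', comm b q'] at f₈
  have g₁ : X.dist q b = X.dist p a := by omega
  have g₂ : X.dist q' b = X.dist p' a := by omega
  have mb : X.dist m b = X.dist m a + 1 := by
    have := tri p m b
    have := hX.dist_lt_or_dist_lt hab m
    omega
  have mb' : X.dist m' a = X.dist m' b + 1 := by
    have := tri q m' a
    have := hX.dist_lt_or_dist_lt hab m'
    omega
  have k₁ := tri p q m'
  have k₂ := tri p' q' m'
  have k₃ := tri p m' p'
  rw [comm m' p'] at k₃
  rw [comm m' q'] at hm₁'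
  rw [comm m p'] at hm₁
  have hm : m ∈ interval X p p' ∧ m ∈ interval X p' b ∧ m ∈ interval X p b := by
    simp only [interval, Set.mem_ofPred_eq]
    rw [comm m p']
    omega
  have hm' : m' ∈ interval X p p' ∧ m' ∈ interval X p' b ∧ m' ∈ interval X p b := by
    simp only [interval, Set.mem_ofPred_eq]
    rw [comm m' p']
    omega
  obtain rfl := (hX.2 p p' b).unique hm hm'
  omega

end IsMedianGraph

theorem exists_adj_dist_eq {X : SimpleGraph V} (hX : X.Connected) {u z : V} {k : ℕ}
    (h : X.dist u z = k + 1) : ∃ u', X.Adj u u' ∧ X.dist u' z = k := by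
  obtain ⟨w, hw⟩ := hX.exists_walk_length_eq_dist u z
  cases w with
  | nil => simp at h
  | @cons _ u' _ hadj w =>
    refine ⟨u', hadj, ?_⟩
    have h₁ := SimpleGraph.dist_le w
    have h₂ := hX.dist_triangle (u := u) (v := u') (w := z)
    have h₃ := SimpleGraph.dist_eq_one_iff_adj.2 hadj
    rw [SimpleGraph.Walk.length_cons] at hw
    omega

theorem exists_adj_leaving {X : SimpleGraph V} (hX : X.Connected) (S : Set V) {u z : V}
    (hu : u ∈ S) (hz : z ∉ S) :
    ∃ p q, X.Adj p q ∧ p ∈ S ∧ q ∉ S ∧ X.dist u p + 1 + X.dist q z = X.dist u z := by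
  induction hk : X.dist u z generalizing u with
  | zero =>
    rw [hX.dist_eq_zero_iff] at hk
    exact absurd (hk ▸ hu) hz
  | succ k ih =>
    obtain ⟨u', hadj, hu'⟩ := exists_adj_dist_eq hX hk
    have h₃ := SimpleGraph.dist_eq_one_iff_adj.2 hadj
    by_cases hS : u' ∈ S
    · obtain ⟨p, q, hpq, hp, hq, hd⟩ := ih hS hu'
      refine ⟨p, q, hpq, hp, hq, ?_⟩
      have h₁ := hX.dist_triangle (u := u) (v := u') (w := p)
      have h₂ := hX.dist_triangle (u := u) (v := p) (w := z)
      have h₄ := hX.dist_triangle (u := p) (v := q) (w := z)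
      have h₅ := SimpleGraph.dist_eq_one_iff_adj.2 hpq
      omega
    · exact ⟨u, u', hadj, hu, hS, by rw [X.dist_self]; omega⟩

namespace IsHalfspace

variable {X : SimpleGraph V} {h k : Set V}

theorem compl (hX : IsMedianGraph X) (hh : IsHalfspace X h) : IsHalfspace X hᶜ := by
  obtain ⟨a, b, hab, rfl⟩ := hh
  refine ⟨b, a, hab.symm, ?_⟩
  ext v
  have := hX.dist_ne_of_adj hab v
  simp only [Set.mem_compl_iff, Set.mem_ofPred_eq]
  omega

theorem convex (hX : IsMedianGraph X) (hh : IsHalfspace X h) {u w z : V}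
    (hu : u ∈ h) (hw : w ∈ h) (hz : z ∈ interval X u w) : z ∈ h := by
  by_contra hzh
  obtain ⟨p, q, hpq, hp, hq, hd⟩ := exists_adj_leaving hX.1 h hu hzh
  obtain ⟨p', q', hpq', hp', hq', hd'⟩ := exists_adj_leaving hX.1 h hw hzh
  obtain ⟨a, b, hab, rfl⟩ := hh
  simp only [interval, Set.mem_ofPred_eq] at *
  have fq := hX.dist_lt_or_dist_lt hab q
  have fq' := hX.dist_lt_or_dist_lt hab q'
  refine hX.not_reenter hab hpq hpq' hp hp' (by omega) (by omega) ?_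
  have tri := fun u v w => hX.1.dist_triangle (u := u) (v := v) (w := w)
  have comm := fun u v => X.dist_comm (u := u) (v := v)
  have e₁ := SimpleGraph.dist_eq_one_iff_adj.2 hpq
  have e₂ := SimpleGraph.dist_eq_one_iff_adj.2 hpq'
  have := tri u p w
  have := tri p p' w
  have := tri q z q'
  have := tri p q p'
  have := tri q q' p'
  rw [comm w p', comm w z] at hd'
  rw [comm q' p'] at *
  rw [comm z q'] at *
  omega

theorem eq_of_adj (hX : IsMedianGraph X) (hh : IsHalfspace X h) {a b : V} (hab : X.Adj a b)
    (ha : a ∉ h) (hb : b ∈ h) : h = {v | X.dist v b < X.dist v a} := by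
  have e := SimpleGraph.dist_eq_one_iff_adj.2 hab
  ext v
  simp only [Set.mem_ofPred_eq]
  have f := hX.dist_lt_or_dist_lt hab v
  constructor
  · intro hv
    by_contra hlt
    exact ha (hh.convex hX hv hb (show X.dist v a + X.dist a b = X.dist v b by omega))
  · intro hlt
    by_contra hv
    refine (hh.compl hX).convex hX hv ha (z := b) ?_ hb
    change X.dist v b + X.dist b a = X.dist v a
    rw [X.dist_comm (u := b)]
    omega

theorem exists_edgeDual (hh : IsHalfspace X h) : ∃ a, a ∉ h ∧ ∃ b, EdgeDual X h a b := by
  obtain ⟨a, b, hab, rfl⟩ := hh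
  refine ⟨b, ?_, a, hab.symm, Or.inr rfl⟩
  simp

end IsHalfspace

theorem sepH_finite {X : SimpleGraph V} (hX : IsMedianGraph X) (x y : V) :
    (sepH X x y).Finite := by
  induction hk : X.dist x y generalizing x with
  | zero =>
    rw [hX.1.dist_eq_zero_iff] at hk
    subst hk
    convert Set.finite_empty
    ext h
    simp [sepH]
  | succ k ih =>
    obtain ⟨x', hadj, hx'⟩ := exists_adj_dist_eq hX.1 hk
    refine ((ih x' hx').insert {v | X.dist v x' < X.dist v x}).subset ?_
    rintro h ⟨hh, hy, hx⟩
    by_cases hmem : x' ∈ h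
    · exact Or.inl (hh.eq_of_adj hX hadj hx hmem)
    · exact Or.inr ⟨hh, hy, hmem⟩

theorem mem_sepH_left {X : SimpleGraph V} (hX : IsMedianGraph X) {x y m : V} {h : Set V}
    (hm : m ∈ interval X x y) : h ∈ sepH X x m ↔ h ∈ sepH X x y ∧ m ∈ h := by
  constructor
  · rintro ⟨hh, hmh, hx⟩
    refine ⟨⟨hh, ?_, hx⟩, hmh⟩
    by_contra hy
    exact (hh.compl hX).convex hX hx hy hm hmh
  · rintro ⟨⟨hh, -, hx⟩, hmh⟩
    exact ⟨hh, hmh, hx⟩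

theorem mem_sepH_right {X : SimpleGraph V} (hX : IsMedianGraph X) {x y m : V} {h : Set V}
    (hm : m ∈ interval X x y) : h ∈ sepH X m y ↔ h ∈ sepH X x y ∧ m ∉ h := by
  constructor
  · rintro ⟨hh, hy, hmh⟩
    refine ⟨⟨hh, hy, ?_⟩, hmh⟩
    intro hx
    exact hmh (hh.convex hX hx hy hm)
  · rintro ⟨⟨hh, hy, -⟩, hmh⟩
    exact ⟨hh, hy, hmh⟩

/-! ### Counting segments through an interior vertex -/

/-- A Ramsey bound: if every pair of distinct elements of `S` is related by one of the relations
`R i`, and cliques for `R i` have at most `c i` elements, then `S` has bounded cardinality. -/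
theorem card_le_of_forall_clique_card_le {α ι : Type*} [Fintype ι] (R : ι → α → α → Prop)
    (hsymm : ∀ i p q, R i p q → R i q p) (N : ℕ) (c : ι → ℕ) (hc : ∑ i, c i ≤ N) (S : Finset α)
    (hcover : ∀ p ∈ S, ∀ q ∈ S, p ≠ q → ∃ i, R i p q)
    (hclique : ∀ i, ∀ T ⊆ S, (∀ p ∈ T, ∀ q ∈ T, p ≠ q → R i p q) → T.card ≤ c i) :
    S.card ≤ (Fintype.card ι + 1) ^ N := by
  classical
  induction N generalizing c S with
  | zero =>
    by_contra! hS
    obtain ⟨p, hp, q, hq, hpq⟩ := Finset.one_lt_card.1 (by simpa using hS)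
    obtain ⟨i, -⟩ := hcover p hp q hq hpq
    have h₁ := hclique i {p} (by simpa using hp) (by simp)
    have h₂ := Finset.single_le_sum (f := c) (fun _ _ => Nat.zero_le _) (Finset.mem_univ i)
    simp at h₁
    omega
  | succ N ih =>
    obtain rfl | ⟨v, hv⟩ := S.eq_empty_or_nonempty
    · simp
    let T : ι → Finset α := fun i => S.filter fun q => v ≠ q ∧ R i v q
    have hT : ∀ i, (T i).card ≤ (Fintype.card ι + 1) ^ N := by
      intro i
      have hci : 1 ≤ c i := by simpa using hclique i {v} (by simpa using hv) (by simp)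
      have hTS : T i ⊆ S := Finset.filter_subset _ _
      refine ih (Function.update c i (c i - 1)) ?_ (T i)
        (fun p hp q hq => hcover p (hTS hp) q (hTS hq)) ?_
      · have h₁ := Finset.add_sum_erase Finset.univ c (Finset.mem_univ i)
        have h₂ := Finset.add_sum_erase Finset.univ (Function.update c i (c i - 1))
          (Finset.mem_univ i)
        have h₃ : ∑ j ∈ Finset.univ.erase i, Function.update c i (c i - 1) j =
            ∑ j ∈ Finset.univ.erase i, c j :=
          Finset.sum_congr rfl fun j hj => Function.update_of_ne (Finset.ne_of_mem_erase hj) _ _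
        rw [Function.update_self] at h₂
        omega
      · intro j U hU hUc
        by_cases hij : j = i
        · subst hij
          have hvU : v ∉ U := fun hvU => (Finset.mem_filter.1 (hU hvU)).2.1 rfl
          have := hclique j (insert v U)
            (Finset.insert_subset hv (hU.trans hTS)) (by
              intro p hp q hq hpq
              rcases Finset.mem_insert.1 hp with rfl | hp' <;>
                rcases Finset.mem_insert.1 hq with rfl | hq'
              · exact absurd rfl hpq
              · exact (Finset.mem_filter.1 (hU hq')).2.2
              · exact hsymm _ _ _ (Finset.mem_filter.1 (hU hp')).2.2
              · exact hUc p hp' q hq' hpq)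
          rw [Finset.card_insert_of_notMem hvU] at this
          rw [Function.update_self]
          omega
        · rw [Function.update_of_ne hij]
          exact hclique j U (hU.trans hTS) hUc
    have hS : S ⊆ insert v (Finset.univ.biUnion T) := by
      intro q hq
      by_cases hvq : v = q
      · exact Finset.mem_insert.2 (Or.inl hvq.symm)
      · obtain ⟨i, hi⟩ := hcover v hv q hq hvq
        exact Finset.mem_insert.2 (Or.inr (Finset.mem_biUnion.2
          ⟨i, Finset.mem_univ i, Finset.mem_filter.2 ⟨hq, hvq, hi⟩⟩))
    calc S.card ≤ (insert v (Finset.univ.biUnion T)).card := Finset.card_le_card hS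
      _ ≤ (Finset.univ.biUnion T).card + 1 := Finset.card_insert_le _ _
      _ ≤ Fintype.card ι * (Fintype.card ι + 1) ^ N + 1 := by
        gcongr
        simpa using Finset.card_biUnion_le_card_mul Finset.univ T _ fun i _ => hT i
      _ ≤ Fintype.card ι * (Fintype.card ι + 1) ^ N + (Fintype.card ι + 1) ^ N := by
        gcongr
        exact Nat.one_le_pow _ _ (Nat.succ_pos _)
      _ = (Fintype.card ι + 1) ^ (N + 1) := by ring

theorem Transv.symm {h k : Set V} (H : Transv h k) : Transv k h := by
  obtain ⟨h₁, h₂, h₃, h₄⟩ := H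
  rw [Set.inter_comm] at h₁ h₂ h₃ h₄
  exact ⟨h₁, h₃, h₂, h₄⟩

theorem not_transv_self (h : Set V) : ¬ Transv h h := fun H => by
  simpa using H.2.1

theorem transv_or_subset_or_subset {X : SimpleGraph V} {x y : V} {h k : Set V}
    (hh : h ∈ sepH X x y) (hk : k ∈ sepH X x y) : Transv h k ∨ h ⊆ k ∨ k ⊆ h := by
  by_cases h₁ : h ⊆ k
  · exact Or.inr (Or.inl h₁)
  by_cases h₂ : k ⊆ h
  · exact Or.inr (Or.inr h₂)
  obtain ⟨p, hp, hpk⟩ := Set.not_subset.1 h₁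
  obtain ⟨q, hq, hqh⟩ := Set.not_subset.1 h₂
  exact Or.inl ⟨⟨y, hh.2.1, hk.2.1⟩, ⟨q, hqh, hq⟩, ⟨p, hp, hpk⟩, ⟨x, hh.2.2, hk.2.2⟩⟩

theorem TightlyNested.not_ssubset {X : SimpleGraph V} {h k h' k' : Set V}
    (ht : TightlyNested X h k) (ht' : TightlyNested X h' k') (hh' : IsHalfspace X h')
    (hsub : h' ⊂ h) : ¬ k ⊆ k' := fun hkk =>
  ht.2 ⟨h', hh', hsub, hkk.trans_ssubset ht'.1⟩

theorem TightlyNested.ssubset_iff {X : SimpleGraph V} {x y : V} {h k h' k' : Set V}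
    (ht : TightlyNested X h k) (ht' : TightlyNested X h' k')
    (hh : h ∈ sepH X x y) (hh' : h' ∈ sepH X x y)
    (hk : k ∈ sepH X x y) (hk' : k' ∈ sepH X x y)
    (hnt : ¬ Transv h h') (hnt' : ¬ Transv k k') : h' ⊂ h ↔ k' ⊂ k := by
  have key := (transv_or_subset_or_subset hk hk').resolve_left hnt'
  have key' := (transv_or_subset_or_subset hh hh').resolve_left hnt
  constructor
  · intro hsub
    have hn := ht.not_ssubset ht' hh'.1 hsub
    exact ⟨key.resolve_left hn, hn⟩
  · intro hsub
    have hn : ¬ h ⊆ h' := by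
      intro hle
      rcases hle.eq_or_ssubset with rfl | hlt
      · exact ht'.2 ⟨k, hk.1, ht.1, hsub⟩
      · exact ht'.not_ssubset ht hh.1 hlt hsub.subset
    exact ⟨key'.resolve_left hn, hn⟩

theorem IsHSegment.subset_of_le {X : SimpleGraph V} {l : ℕ} {t : Fin l → Set V}
    (ht : IsHSegment X l t) {i j : Fin l} (hij : i ≤ j) : t j ⊆ t i := by
  obtain ⟨i, hi⟩ := i
  obtain ⟨j, hj⟩ := j
  replace hij : i ≤ j := hij
  induction j, hij using Nat.le_induction with
  | base => exact subset_rfl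
  | succ j _ ih => exact (ht.2 ⟨j, by omega⟩ ⟨j + 1, hj⟩ rfl).1.subset.trans (ih (by omega))

/-- Distinct segments in `[x,y]_H` without transverse entries in equal positions are strictly nested
in every position. -/
theorem IsHSegment.comparable {X : SimpleGraph V} {x y : V} {l : ℕ} {t t' : Fin l → Set V}
    (ht : IsHSegment X l t) (ht' : IsHSegment X l t')
    (hin : SegIn X x y t) (hin' : SegIn X x y t')
    (hnt : ∀ i, ¬ Transv (t i) (t' i)) (hne : t ≠ t') :
    (∀ i, t' i ⊂ t i) ∨ ∀ i, t i ⊂ t' i := by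
  have hnt' : ∀ i, ¬ Transv (t' i) (t i) := fun i H => hnt i H.symm
  have prop : ∀ t t' : Fin l → Set V, IsHSegment X l t → IsHSegment X l t' →
      SegIn X x y t → SegIn X x y t' → (∀ i, ¬ Transv (t i) (t' i)) →
      ∀ i j : Fin l, i ≤ j → (t' i ⊂ t i ↔ t' j ⊂ t j) := by
    rintro t t' ht ht' hin hin' hnt ⟨i, hi⟩ ⟨j, hj⟩ hij
    replace hij : i ≤ j := hij
    induction j, hij using Nat.le_induction with
    | base => rfl
    | succ j _ ih =>
      exact (ih (by omega)).trans ((ht.2 ⟨j, by omega⟩ ⟨j + 1, hj⟩ rfl).ssubset_iff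
        (ht'.2 ⟨j, by omega⟩ ⟨j + 1, hj⟩ rfl) (hin _) (hin' _) (hin _) (hin' _) (hnt _) (hnt _))
  have all : ∀ t t' : Fin l → Set V, IsHSegment X l t → IsHSegment X l t' →
      SegIn X x y t → SegIn X x y t' → (∀ i, ¬ Transv (t i) (t' i)) →
      ∀ i, t' i ⊂ t i → ∀ j, t' j ⊂ t j := by
    intro t t' ht ht' hin hin' hnt i hi j
    rcases le_total i j with hij | hij
    · exact (prop t t' ht ht' hin hin' hnt i j hij).1 hi
    · exact (prop t t' ht ht' hin hin' hnt j i hij).2 hi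
  obtain ⟨i, hi⟩ := Function.ne_iff.1 hne
  rcases (transv_or_subset_or_subset (hin i) (hin' i)).resolve_left (hnt i) with hsub | hsub
  · exact Or.inr (all t' t ht' ht hin' hin hnt' i (hsub.ssubset_of_ne hi))
  · exact Or.inl (all t t' ht ht' hin hin' hnt i (hsub.ssubset_of_ne (Ne.symm hi)))

theorem exists_fin_enumeration {α : Type*} [Fintype α] (r : α → α → Prop)
    [IsStrictTotalOrder α r] {k : ℕ} (hk : Fintype.card α = k) :
    ∃ e : Fin k → α, ∀ a b, a < b → r (e a) (e b) := by
  classical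
  let _ : LinearOrder α := linearOrderOfSTO r
  let e := Fintype.orderIsoFinOfCardEq α hk
  refine ⟨e, fun a b hab => ?_⟩
  have h : e a < e b := e.strictMono hab
  exact h

/-- A family of segments that is totally ordered by strict inclusion, all members of which are
crossed by `m` at position `i`, yields a staircase. -/
theorem card_le_of_chain {X : SimpleGraph V} {σ : ℕ} (hstair : StaircaseLE X σ) {x y m : V}
    {l : ℕ} {i j : Fin l} (hij : (j : ℕ) = i + 1) (T : Finset (Fin l → Set V))
    (hseg : ∀ t ∈ T, IsHSegment X l t ∧ SegIn X x y t ∧ m ∈ t i ∧ m ∉ t j)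
    (hT : ∀ t ∈ T, ∀ t' ∈ T, t ≠ t' → (∀ i, t' i ⊂ t i) ∨ ∀ i, t i ⊂ t' i) :
    T.card ≤ σ := by
  classical
  by_contra! hcard
  obtain ⟨U, hUT, hU⟩ := Finset.exists_subset_card_eq (Nat.succ_le_of_lt hcard)
  let r : {t // t ∈ U} → {t // t ∈ U} → Prop := fun t t' => ∀ i, t'.1 i ⊂ t.1 i
  have : IsStrictTotalOrder {t // t ∈ U} r :=
    { irrefl := fun t ht => (ht i).ne rfl
      trans := fun a b c hab hbc i => (hbc i).trans (hab i)
      trichotomous := fun a b hab hba => by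
        by_contra hne
        rcases hT a.1 (hUT a.2) b.1 (hUT b.2) (fun h => hne (Subtype.ext h)) with h | h
        · exact hab h
        · exact hba h }
  obtain ⟨e, he⟩ := exists_fin_enumeration r (k := σ + 1) (by simpa using hU)
  have hs := fun a => hseg (e a).1 (hUT (e a).2)
  refine hstair (fun a => (e a).1 i) (fun a => (e a).1 j)
    ⟨fun a => (hs a).1.1 i, fun a => (hs a).1.1 j, fun a b hab => he a b hab i,
      fun a b hab => he a b hab j, fun a => ((hs a).1.2 i j hij).1, fun a b hba => ?_⟩
  rcases transv_or_subset_or_subset ((hs a).2.1 i) ((hs b).2.1 j) with h | h | h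
  · exact h
  · exact absurd (h (hs a).2.2.1) (hs b).2.2.2
  · exact absurd ⟨(e a).1 i, (hs a).1.1 i, he b a hba i,
      h.ssubset_of_ne fun heq => (hs b).2.2.2 (heq ▸ (hs a).2.2.1)⟩ ((hs b).1.2 i j hij).2

/-- The number of segments in `[x,y]_H` having `m` in their interior is bounded. -/
theorem card_le_of_crossing {X : SimpleGraph V} {D σ : ℕ} (hdim : DimLE X D)
    (hstair : StaircaseLE X σ) {x y m : V} {l : ℕ} {i j : Fin l} (hij : (j : ℕ) = i + 1)
    (S : Finset (Fin l → Set V))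
    (hseg : ∀ t ∈ S, IsHSegment X l t ∧ SegIn X x y t ∧ m ∈ t i ∧ m ∉ t j) :
    S.card ≤ (l + 2) ^ (l * D + σ) := by
  classical
  let R : Option (Fin l) → (Fin l → Set V) → (Fin l → Set V) → Prop := fun o t t' =>
    o.elim ((∀ i, t' i ⊂ t i) ∨ ∀ i, t i ⊂ t' i) fun i => Transv (t i) (t' i)
  have := card_le_of_forall_clique_card_le R ?_ (l * D + σ) (fun o => o.elim σ fun _ => D) ?_ S
    ?_ ?_
  · simpa [add_assoc] using this
  · rintro (_ | i) p q hpq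
    · exact Or.symm hpq
    · exact Transv.symm hpq
  · simp [Fintype.sum_option, add_comm]
  · intro p hp q hq hpq
    by_cases hnt : ∃ i, Transv (p i) (q i)
    · obtain ⟨i, hi⟩ := hnt
      exact ⟨some i, hi⟩
    · exact ⟨none, (hseg p hp).1.comparable (hseg q hq).1 (hseg p hp).2.1 (hseg q hq).2.1
        (not_exists.1 hnt) hpq⟩
  · rintro (_ | i) T hTS hT
    · exact card_le_of_chain hstair hij T (fun t ht => hseg t (hTS ht)) hT
    · have hinj : Set.InjOn (fun t : Fin l → Set V => t i) T := by
        intro p hp q hq hpq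
        by_contra hne
        have h : Transv (p i) (q i) := hT p hp q hq hne
        have hpq : p i = q i := hpq
        rw [hpq] at h
        exact not_transv_self _ h
      rw [← Finset.card_image_of_injOn hinj]
      refine hdim _ ?_ ?_
      · intro h hh
        obtain ⟨t, ht, rfl⟩ := Finset.mem_image.1 hh
        exact (hseg t (hTS ht)).1.1 i
      · intro h hh k hk hne
        obtain ⟨t, ht, rfl⟩ := Finset.mem_image.1 hh
        obtain ⟨t', ht', rfl⟩ := Finset.mem_image.1 hk
        exact hT t ht t' ht' fun heq => hne (by rw [heq])

/-! ### Homogeneous cochains -/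

section Cochains

variable {W : Type*}

/-- The simplicial coboundary operator, including the one defined on constants. -/
noncomputable def cochainD {m : ℕ} (β : (Fin m → W) → ℝ) : (Fin (m + 1) → W) → ℝ :=
  fun x => ∑ j : Fin (m + 1), (-1 : ℝ) ^ (j : ℕ) * β (fun i => x (j.succAbove i))

theorem cochainD_cons {m : ℕ} (β : (Fin (m + 1) → W) → ℝ) (a : W) (x : Fin (m + 1) → W) :
    cochainD β (Fin.cons a x) = β x - cochainD (fun y => β (Fin.cons a y)) x := by
  have key : ∀ j : Fin (m + 1),
      (fun i => (Fin.cons a x : Fin (m + 2) → W) (j.succ.succAbove i)) =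
        Fin.cons a fun i => x (j.succAbove i) := by
    intro j
    funext i
    refine Fin.cases ?_ (fun i => ?_) i
    · simp
    · simp
  simp only [cochainD]
  rw [Fin.sum_univ_succ]
  simp only [key, Fin.val_succ, Fin.succAbove_zero, Fin.cons_succ, Fin.val_zero, pow_zero, one_mul,
    pow_succ, mul_neg, mul_one, neg_mul, Finset.sum_neg_distrib, sub_eq_add_neg]

theorem cochainD_add {m : ℕ} (β β' : (Fin m → W) → ℝ) :
    cochainD (fun v => β v + β' v) = fun v => cochainD β v + cochainD β' v := by
  funext v
  simp [cochainD, mul_add, Finset.sum_add_distrib]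

theorem cochainD_sub {m : ℕ} (β β' : (Fin m → W) → ℝ) :
    cochainD (fun v => β v - β' v) = fun v => cochainD β v - cochainD β' v := by
  funext v
  simp [cochainD, mul_sub, Finset.sum_sub_distrib]

theorem cochainD_const_mul {m : ℕ} (c : ℝ) (β : (Fin m → W) → ℝ) :
    cochainD (fun v => c * β v) = fun v => c * cochainD β v := by
  funext v
  simp only [cochainD, Finset.mul_sum]
  exact Finset.sum_congr rfl fun _ _ => by ring

theorem cochainD_sum {m : ℕ} {α : Type*} (T : Finset α) (β : α → (Fin m → W) → ℝ) :
    cochainD (fun v => ∑ t ∈ T, β t v) = fun v => ∑ t ∈ T, cochainD (β t) v := by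
  funext v
  simp only [cochainD, Finset.mul_sum]
  exact Finset.sum_comm

theorem cochainD_cochainD {m : ℕ} (β : (Fin m → W) → ℝ) (v : Fin (m + 2) → W) :
    cochainD (cochainD β) v = 0 := by
  induction m with
  | zero =>
    simp only [cochainD, Fin.sum_univ_succ]
    simp [Subsingleton.elim _ (default : Fin 0 → W)]
  | succ m ih =>
    obtain ⟨a, v, rfl⟩ : ∃ a u, v = Fin.cons a u := ⟨v 0, Fin.tail v, (Fin.cons_self_tail v).symm⟩
    simp only [cochainD_cons, cochainD_sub, ih, sub_zero, sub_self]

/-- If `P` is a family of functions whose partial coboundary computes the cup product `f ∪ κ`, then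
the coboundary of `P` in its first two arguments is a primitive of `δf ∪ κ`. -/
theorem cochainD_eq_cup {k : ℕ} (f : W → W → ℝ) (P : W → W → (Fin (k + 1) → W) → ℝ)
    (κ : (Fin (k + 2) → W) → ℝ) (hκ : cochainD κ = 0)
    (hP : ∀ a b u, cochainD (fun w : Fin k → W => P a b (Fin.cons b w)) u =
      P a b u - f a b * κ (Fin.cons b u)) (v : Fin (k + 4) → W) :
    cochainD (fun v : Fin (k + 3) → W => d1 (fun a b => P a b (Fin.tail (Fin.tail v)))
      (v 0) (v 1) (v 2)) v = d1 f (v 0) (v 1) (v 2) * κ (Fin.tail (Fin.tail v)) := by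
  have hcons : ∀ {m : ℕ} (v : Fin (m + 1) → W), ∃ a u, v = Fin.cons a u :=
    fun v => ⟨v 0, Fin.tail v, (Fin.cons_self_tail v).symm⟩
  have hβ : (fun v : Fin (k + 3) → W => d1 (fun a b => P a b (Fin.tail (Fin.tail v)))
      (v 0) (v 1) (v 2)) = fun v => f (v 0) (v 1) * κ (Fin.tail v) +
        cochainD (fun u : Fin (k + 2) → W => P (u 0) (u 1) (Fin.tail u)) v := by
    funext v
    obtain ⟨a, v, rfl⟩ := hcons v
    obtain ⟨b, u, rfl⟩ := hcons v
    have h₁ : ∀ {m : ℕ} (p : W) (y : Fin (m + 1) → W), (Fin.cons p y : Fin (m + 2) → W) 1 = y 0 :=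
      fun _ _ => rfl
    have h₂ : (Fin.cons a (Fin.cons b u : Fin (k + 2) → W) : Fin (k + 3) → W) 2 = u 0 := rfl
    simp only [cochainD_cons, h₁, h₂, Fin.cons_zero, Fin.tail_cons, hP, d1]
    ring
  rw [hβ, cochainD_add]
  simp only [cochainD_cochainD, add_zero]
  obtain ⟨a, v, rfl⟩ := hcons v
  obtain ⟨b, v, rfl⟩ := hcons v
  obtain ⟨c, u, rfl⟩ := hcons v
  have h₁ : ∀ {m : ℕ} (p : W) (y : Fin (m + 1) → W), (Fin.cons p y : Fin (m + 2) → W) 1 = y 0 :=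
    fun _ _ => rfl
  have h₂ : (Fin.cons a (Fin.cons b (Fin.cons c u : Fin (k + 2) → W) : Fin (k + 3) → W) :
    Fin (k + 4) → W) 2 = c := rfl
  have h₃ : κ (Fin.cons c u) - cochainD (fun y => κ (Fin.cons b y)) (Fin.cons c u) = 0 := by
    rw [← cochainD_cons, hκ, Pi.zero_apply]
  simp only [cochainD_cons, h₁, h₂, Fin.cons_zero, Fin.tail_cons, cochainD_const_mul, d1] at h₃ ⊢
  linear_combination (-f a b) * h₃

end Cochains

/-! ### Translates of a segment -/

section Action

variable {X : SimpleGraph V} {Γ : Type*} [Group Γ] [MulAction Γ V] {l : ℕ}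

theorem mem_image_smul_iff {γ : Γ} {h : Set V} {v : V} : v ∈ (γ • ·) '' h ↔ γ⁻¹ • v ∈ h := by
  constructor
  · rintro ⟨u, hu, rfl⟩
    simpa using hu
  · intro hv
    exact ⟨_, hv, smul_inv_smul γ v⟩

theorem smul_mem_image_smul_iff {γ : Γ} {h : Set V} {v : V} : γ • v ∈ (γ • ·) '' h ↔ v ∈ h := by
  rw [mem_image_smul_iff, inv_smul_smul]

theorem ActsOn.dist_smul (hX : X.Connected) (hact : ActsOn Γ X) (γ : Γ) (a b : V) :
    X.dist (γ • a) (γ • b) = X.dist a b := by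
  have key : ∀ (γ : Γ) (a b : V), X.dist (γ • a) (γ • b) ≤ X.dist a b := by
    intro γ a b
    obtain ⟨w, hw⟩ := hX.exists_walk_length_eq_dist a b
    let φ : X →g X := ⟨(γ • ·), fun h => hact γ _ _ h⟩
    rw [← hw, ← w.length_map φ]
    exact SimpleGraph.dist_le (w.map φ)
  refine le_antisymm (key γ a b) ?_
  simpa using key γ⁻¹ (γ • a) (γ • b)

theorem ActsOn.image_dist_lt (hX : X.Connected) (hact : ActsOn Γ X) (γ : Γ) (a b : V) :
    (γ • ·) '' {v | X.dist v a < X.dist v b} =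
      {v | X.dist v (γ • a) < X.dist v (γ • b)} := by
  ext v
  rw [mem_image_smul_iff, Set.mem_ofPred_eq, Set.mem_ofPred_eq, ← hact.dist_smul hX γ,
    ← hact.dist_smul hX γ (γ⁻¹ • v) b, smul_inv_smul]

theorem IsHalfspace.smul (hX : X.Connected) (hact : ActsOn Γ X) (γ : Γ) {h : Set V}
    (hh : IsHalfspace X h) : IsHalfspace X ((γ • ·) '' h) := by
  obtain ⟨a, b, hab, rfl⟩ := hh
  exact ⟨γ • a, γ • b, hact γ a b hab, hact.image_dist_lt hX γ a b⟩

theorem EdgeDual.smul (hX : X.Connected) (hact : ActsOn Γ X) (γ : Γ) {h : Set V} {a b : V}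
    (hh : EdgeDual X h a b) : EdgeDual X ((γ • ·) '' h) (γ • a) (γ • b) := by
  obtain ⟨hab, rfl | rfl⟩ := hh
  · exact ⟨hact γ a b hab, Or.inl (hact.image_dist_lt hX γ a b)⟩
  · exact ⟨hact γ a b hab, Or.inr (hact.image_dist_lt hX γ b a)⟩

theorem segSMul_mul (γ δ : Γ) (t : Fin l → Set V) :
    segSMul (γ * δ) t = segSMul γ (segSMul δ t) := by
  funext i
  simp only [segSMul, Set.image_image, mul_smul]

theorem segSMul_inv_segSMul (γ : Γ) (t : Fin l → Set V) : segSMul γ⁻¹ (segSMul γ t) = t := by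
  funext i
  simp [segSMul, Set.image_image]

theorem segSMul_injective (γ : Γ) : Function.Injective (segSMul γ : (Fin l → Set V) → _) :=
  Function.LeftInverse.injective (segSMul_inv_segSMul γ)

theorem IsHSegment.smul (hX : X.Connected) (hact : ActsOn Γ X) (γ : Γ) {t : Fin l → Set V}
    (ht : IsHSegment X l t) : IsHSegment X l (segSMul γ t) := by
  refine ⟨fun i => (ht.1 i).smul hX hact γ, fun i j hij => ?_⟩
  obtain ⟨h₁, h₂⟩ := ht.2 i j hij
  have himg : ∀ {h k : Set V}, (γ • ·) '' h ⊂ (γ • ·) '' k ↔ h ⊂ k :=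
    (MulAction.injective γ).injOn.image_ssubset_image_iff (Set.subset_univ _) (Set.subset_univ _)
  refine ⟨himg.2 h₁, ?_⟩
  rintro ⟨h', hh', hlt, hlt'⟩
  have heq : (γ • ·) '' ((γ⁻¹ • ·) '' h') = h' := by simp [Set.image_image]
  rw [← heq] at hlt hlt'
  exact h₂ ⟨(γ⁻¹ • ·) '' h', hh'.smul hX hact γ⁻¹, himg.1 hlt, himg.1 hlt'⟩

theorem IsHead.smul (hX : X.Connected) (hact : ActsOn Γ X) (γ : Γ) {hl : 0 < l}
    {t : Fin l → Set V} {a : V} (ha : IsHead X hl t a) :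
    IsHead X hl (segSMul γ t) (γ • a) := by
  obtain ⟨h₁, b, h₂⟩ := ha
  exact ⟨fun h => h₁ (smul_mem_image_smul_iff.1 h), γ • b, h₂.smul hX hact γ⟩

theorem translatesIn_finite (hX : IsMedianGraph X) (s : Fin l → Set V) (x y : V) :
    (translatesIn X Γ s x y).Finite :=
  (Set.Finite.pi' fun _ : Fin l => sepH_finite hX x y).subset fun _ ht => ht.2

theorem segSMul_mem_translatesIn (hX : X.Connected) (hact : ActsOn Γ X) (γ : Γ)
    {s t : Fin l → Set V} {x y : V} (ht : t ∈ translatesIn X Γ s x y) :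
    segSMul γ t ∈ translatesIn X Γ s (γ • x) (γ • y) := by
  obtain ⟨⟨δ, rfl⟩, ht⟩ := ht
  refine ⟨⟨γ * δ, (segSMul_mul γ δ s).symm⟩, fun i => ?_⟩
  obtain ⟨h₁, h₂, h₃⟩ := ht i
  exact ⟨h₁.smul hX hact γ, smul_mem_image_smul_iff.2 h₂, fun h => h₃ (smul_mem_image_smul_iff.1 h)⟩

theorem translatesIn_smul (hX : X.Connected) (hact : ActsOn Γ X) (γ : Γ)
    (s : Fin l → Set V) (x y : V) :
    translatesIn X Γ s (γ • x) (γ • y) = segSMul γ '' translatesIn X Γ s x y := by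
  ext t
  constructor
  · intro ht
    refine ⟨segSMul γ⁻¹ t, ?_, ?_⟩
    · simpa using segSMul_mem_translatesIn hX hact γ⁻¹ ht
    · simpa using segSMul_inv_segSMul γ⁻¹ t
  · rintro ⟨t, ht, rfl⟩
    exact segSMul_mem_translatesIn hX hact γ ht

/-- The sum of the weights `c t` over the translates `t` of `s` contained in `[x,y]_H`. -/
noncomputable def translateSum (X : SimpleGraph V) (Γ : Type*) [SMul Γ V] {l : ℕ}
    (s : Fin l → Set V) (c : (Fin l → Set V) → ℝ) (x y : V) : ℝ :=
  ∑ᶠ t ∈ translatesIn X Γ s x y, c t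

/-- The antisymmetrization of `translateSum`, a weighted version of `fs`. -/
noncomputable def weightedFs (X : SimpleGraph V) (Γ : Type*) [SMul Γ V] {l : ℕ}
    (s : Fin l → Set V) (c : (Fin l → Set V) → ℝ) (x y : V) : ℝ :=
  translateSum X Γ s c x y - translateSum X Γ s c y x

theorem translateSum_eq_sum (hX : IsMedianGraph X) (s : Fin l → Set V)
    (c : (Fin l → Set V) → ℝ) (x y : V) :
    translateSum X Γ s c x y = ∑ t ∈ (translatesIn_finite (Γ := Γ) hX s x y).toFinset, c t :=
  finsum_mem_eq_finite_toFinset_sum c _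

theorem fs_eq_weightedFs (hX : IsMedianGraph X) (s : Fin l → Set V) (x y : V) :
    fs X Γ s x y = weightedFs X Γ s 1 x y := by
  simp only [fs, weightedFs, translateSum_eq_sum hX,
    Set.ncard_eq_toFinset_card _ (translatesIn_finite (Γ := Γ) hX s _ _), Pi.one_apply,
    Finset.sum_const, nsmul_eq_mul, mul_one]

theorem translateSum_smul (hX : X.Connected) (hact : ActsOn Γ X) (γ : Γ) {s : Fin l → Set V}
    {c c' : (Fin l → Set V) → ℝ} (hc : ∀ δ : Γ, c (segSMul γ (segSMul δ s)) = c' (segSMul δ s))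
    (x y : V) : translateSum X Γ s c (γ • x) (γ • y) = translateSum X Γ s c' x y := by
  rw [translateSum, translatesIn_smul hX hact, finsum_mem_image (segSMul_injective γ).injOn]
  refine finsum_mem_congr rfl ?_
  rintro t ⟨⟨δ, rfl⟩, -⟩
  exact hc δ

theorem weightedFs_smul (hX : X.Connected) (hact : ActsOn Γ X) (γ : Γ) {s : Fin l → Set V}
    {c c' : (Fin l → Set V) → ℝ} (hc : ∀ δ : Γ, c (segSMul γ (segSMul δ s)) = c' (segSMul δ s))
    (x y : V) : weightedFs X Γ s c (γ • x) (γ • y) = weightedFs X Γ s c' x y := by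
  rw [weightedFs, weightedFs, translateSum_smul hX hact γ hc, translateSum_smul hX hact γ hc]

theorem IsHSegment.exists_crossing {t : Fin l → Set V} (ht : IsHSegment X l t) {m : V}
    {i j : Fin l} (hi : m ∈ t i) (hj : m ∉ t j) :
    ∃ p : {p : Fin l × Fin l // (p.2 : ℕ) = p.1 + 1}, m ∈ t p.1.1 ∧ m ∉ t p.1.2 := by
  by_contra! H
  rcases le_total j i with hji | hij
  · exact hj (ht.subset_of_le hji hi)
  · obtain ⟨i, hil⟩ := i
    obtain ⟨j, hjl⟩ := j
    replace hij : i ≤ j := hij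
    apply hj
    clear hj
    induction j, hij using Nat.le_induction with
    | base => exact hi
    | succ j _ ih =>
      exact H ⟨(⟨j, by omega⟩, ⟨j + 1, hjl⟩), rfl⟩ (ih (by omega))

theorem exists_translateSum_split (hX : IsMedianGraph X) {D σ : ℕ} (hdim : DimLE X D)
    (hstair : StaircaseLE X σ) (hact : ActsOn Γ X) (hl : 0 < l) {s : Fin l → Set V}
    (hs : IsHSegment X l s) :
    ∃ K : ℕ, ∀ (c : (Fin l → Set V) → ℝ) (C : ℝ), (∀ t, |c t| ≤ C) →
      ∀ x y m, m ∈ interval X x y →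
        |translateSum X Γ s c x y - translateSum X Γ s c x m - translateSum X Γ s c m y| ≤
          K * C := by
  classical
  refine ⟨∑ p : {p : Fin l × Fin l // (p.2 : ℕ) = p.1 + 1}, (l + 2) ^ (l * D + σ), ?_⟩
  intro c C hC x y m hm
  simp only [translateSum_eq_sum hX]
  set A := (translatesIn_finite (Γ := Γ) hX s x y).toFinset with hA
  set B₁ := (translatesIn_finite (Γ := Γ) hX s x m).toFinset with hB₁
  set B₂ := (translatesIn_finite (Γ := Γ) hX s m y).toFinset with hB₂
  have hB₁mem : ∀ t, t ∈ B₁ ↔ t ∈ A ∧ ∀ i, m ∈ t i := by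
    intro t
    simp only [hA, hB₁, Set.Finite.mem_toFinset, translatesIn, SegIn, mem_sepH_left hX hm,
      Set.mem_ofPred_eq, forall_and, and_assoc]
  have hB₂mem : ∀ t, t ∈ B₂ ↔ t ∈ A ∧ ∀ i, m ∉ t i := by
    intro t
    simp only [hA, hB₂, Set.Finite.mem_toFinset, translatesIn, SegIn, mem_sepH_right hX hm,
      Set.mem_ofPred_eq, forall_and, and_assoc]
  have hdisj : Disjoint B₁ B₂ := Finset.disjoint_left.2 fun t h₁ h₂ =>
    ((hB₂mem t).1 h₂).2 ⟨0, hl⟩ (((hB₁mem t).1 h₁).2 ⟨0, hl⟩)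
  have hsub : B₁ ∪ B₂ ⊆ A := Finset.union_subset (fun t h => ((hB₁mem t).1 h).1)
    fun t h => ((hB₂mem t).1 h).1
  have hseg : ∀ t ∈ A, IsHSegment X l t ∧ SegIn X x y t := by
    intro t ht
    obtain ⟨⟨γ, rfl⟩, hin⟩ := (Set.Finite.mem_toFinset _).1 ht
    exact ⟨hs.smul hX.1 hact γ, hin⟩
  have hcard : (A \ (B₁ ∪ B₂)).card ≤
      ∑ p : {p : Fin l × Fin l // (p.2 : ℕ) = p.1 + 1}, (l + 2) ^ (l * D + σ) := by
    have hcov : A \ (B₁ ∪ B₂) ⊆ Finset.univ.biUnion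
        fun p : {p : Fin l × Fin l // (p.2 : ℕ) = p.1 + 1} =>
          A.filter fun t => m ∈ t p.1.1 ∧ m ∉ t p.1.2 := by
      intro t ht
      obtain ⟨htA, htB⟩ := Finset.mem_sdiff.1 ht
      simp only [Finset.mem_union, hB₁mem, hB₂mem, htA, true_and, not_or, not_forall,
        not_not] at htB
      obtain ⟨⟨j, hj⟩, i, hi⟩ := htB
      obtain ⟨p, hp⟩ := (hseg t htA).1.exists_crossing hi hj
      exact Finset.mem_biUnion.2 ⟨p, Finset.mem_univ p, Finset.mem_filter.2 ⟨htA, hp⟩⟩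
    refine (Finset.card_le_card hcov).trans (Finset.card_biUnion_le.trans ?_)
    refine Finset.sum_le_sum fun p _ => card_le_of_crossing (x := x) (y := y) (m := m) hdim hstair
      p.2 _ fun t ht => ?_
    obtain ⟨htA, htm⟩ := Finset.mem_filter.1 ht
    exact ⟨(hseg t htA).1, (hseg t htA).2, htm⟩
  have hsum : ∑ t ∈ A, c t - ∑ t ∈ B₁, c t - ∑ t ∈ B₂, c t = ∑ t ∈ A \ (B₁ ∪ B₂), c t := by
    rw [← Finset.sum_sdiff hsub, Finset.sum_union hdisj]
    ring
  have hC0 : 0 ≤ C := (abs_nonneg _).trans (hC s)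
  rw [hsum]
  calc |∑ t ∈ A \ (B₁ ∪ B₂), c t| ≤ ∑ t ∈ A \ (B₁ ∪ B₂), |c t| := Finset.abs_sum_le_sum_abs _ _
    _ ≤ (A \ (B₁ ∪ B₂)).card * C := by
      simpa using Finset.sum_le_sum fun t (_ : t ∈ A \ (B₁ ∪ B₂)) => hC t
    _ ≤ _ := by gcongr

theorem interval_comm (X : SimpleGraph V) (x y : V) : interval X x y = interval X y x := by
  ext m
  simp only [interval, Set.mem_ofPred_eq]
  rw [X.dist_comm (u := x) (v := m), X.dist_comm (u := m) (v := y), X.dist_comm (u := x) (v := y),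
    add_comm]

/-- Weighted median quasimorphisms have uniformly bounded defect. -/
theorem exists_abs_d1_weightedFs_le (hX : IsMedianGraph X) {D σ : ℕ} (hdim : DimLE X D)
    (hstair : StaircaseLE X σ) (hact : ActsOn Γ X) (hl : 0 < l) {s : Fin l → Set V}
    (hs : IsHSegment X l s) :
    ∃ K : ℕ, ∀ (c : (Fin l → Set V) → ℝ) (C : ℝ), (∀ t, |c t| ≤ C) →
      ∀ x y z, |d1 (weightedFs X Γ s c) x y z| ≤ K * C := by
  obtain ⟨K, hK⟩ := exists_translateSum_split (Γ := Γ) hX hdim hstair hact hl hs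
  refine ⟨6 * K, fun c C hC x y z => ?_⟩
  obtain ⟨m, ⟨hxy, hyz, hxz⟩, -⟩ := hX.2 x y z
  have h₁ := abs_le.1 (hK c C hC x y m hxy)
  have h₂ := abs_le.1 (hK c C hC y z m hyz)
  have h₃ := abs_le.1 (hK c C hC x z m hxz)
  have h₄ := abs_le.1 (hK c C hC y x m (interval_comm X x y ▸ hxy))
  have h₅ := abs_le.1 (hK c C hC z y m (interval_comm X y z ▸ hyz))
  have h₆ := abs_le.1 (hK c C hC z x m (interval_comm X x z ▸ hxz))
  simp only [d1, weightedFs]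
  push_cast
  rw [abs_le]
  constructor <;> linarith

/-- The partial coboundary of a weighted median quasimorphism with weights given by a cocycle. -/
theorem cochainD_weightedFs (hX : IsMedianGraph X) (s : Fin l → Set V) {k : ℕ}
    (κ : (Fin (k + 2) → V) → ℝ) (hκ : cochainD κ = 0) (head : (Fin l → Set V) → V) (a b : V)
    (u : Fin (k + 1) → V) :
    cochainD (fun w : Fin k → V =>
        weightedFs X Γ s (fun t => κ (Fin.cons (head t) (Fin.cons b w))) a b) u =
      weightedFs X Γ s (fun t => κ (Fin.cons (head t) u)) a b -
        fs X Γ s a b * κ (Fin.cons b u) := by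
  have key : ∀ p, cochainD (fun w : Fin k → V => κ (Fin.cons p (Fin.cons b w))) u =
      κ (Fin.cons p u) - κ (Fin.cons b u) := by
    intro p
    have h : cochainD κ (Fin.cons p (Fin.cons b u)) = 0 := by rw [hκ, Pi.zero_apply]
    rw [cochainD_cons, cochainD_cons] at h
    linarith
  rw [fs_eq_weightedFs hX]
  simp only [weightedFs, translateSum_eq_sum hX, cochainD_sub, cochainD_sum, key,
    Finset.sum_sub_distrib, Finset.sum_const, Pi.one_apply, nsmul_eq_mul]
  ring

end Action

/-- The cup product of the defect of a median quasimorphism with a non-transverse bounded cocycle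
has a bounded invariant primitive on the vertex set. -/
theorem exists_bounded_invariant_primitive {X : SimpleGraph V} {D σ : ℕ}
    (hX : IsMedianGraph X) (hdim : DimLE X D) (hstair : StaircaseLE X σ)
    {Γ : Type*} [Group Γ] [MulAction Γ V] (hact : ActsOn Γ X)
    {l : ℕ} (hl : 0 < l) {s : Fin l → Set V} (hseg : IsHSegment X l s)
    {k : ℕ} {κ : (Fin (k + 2) → V) → ℝ}
    (hκb : IsBounded κ) (hκinv : IsInvariant Γ κ) (hκcoc : cob κ = 0)
    (hκnt : ∀ γ : Γ, NonTransverseTo X hl κ (segSMul γ s)) :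
    ∃ β : (Fin (k + 3) → V) → ℝ, IsBounded β ∧ IsInvariant Γ β ∧
      ∀ v : Fin (k + 4) → V,
        cob β v = d1 (fs X Γ s) (v 0) (v 1) (v 2) * κ (Fin.tail (Fin.tail v)) := by
  have : Nonempty V := hX.1.nonempty
  let head : (Fin l → Set V) → V := fun t => Classical.epsilon (IsHead X hl t)
  have hhead : ∀ γ : Γ, IsHead X hl (segSMul γ s) (head (segSMul γ s)) := fun γ =>
    Classical.epsilon_spec (((hseg.1 _).smul hX.1 hact γ).exists_edgeDual)
  refine ⟨fun v => d1 (fun a b => weightedFs X Γ s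
    (fun t => κ (Fin.cons (head t) (Fin.tail (Fin.tail v)))) a b) (v 0) (v 1) (v 2), ?_, ?_, ?_⟩
  · obtain ⟨K, hK⟩ := exists_abs_d1_weightedFs_le (Γ := Γ) hX hdim hstair hact hl hseg
    obtain ⟨C, hC⟩ := hκb
    exact ⟨K * C, fun v => hK _ C (fun t => hC _) _ _ _⟩
  · intro γ v
    have hw : ∀ a b, weightedFs X Γ s
        (fun t => κ (Fin.cons (head t) (Fin.tail (Fin.tail fun i => γ • v i)))) (γ • a) (γ • b) =
        weightedFs X Γ s (fun t => κ (Fin.cons (head t) (Fin.tail (Fin.tail v)))) a b := by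
      refine weightedFs_smul hX.1 hact γ fun δ => ?_
      rw [← hκinv γ (Fin.cons (head (segSMul δ s)) _), ← segSMul_mul,
        (hκnt (γ * δ)).1 _ _ _ (hhead (γ * δ))
          (segSMul_mul γ δ s ▸ (hhead δ).smul hX.1 hact γ)]
      congr 1
      funext i
      refine Fin.cases ?_ (fun i => ?_) i <;> rfl
    simp only [d1, hw]
  · exact cochainD_eq_cup (fs X Γ s)
      (fun a b u => weightedFs X Γ s (fun t => κ (Fin.cons (head t) u)) a b) κ hκcoc
      fun a b u => cochainD_weightedFs hX s κ hκcoc head a b u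

/-- Corollary `cor:mainccc:groups`: under the hypotheses of
Statement 2 and a base vertex `x`, the pullback cup product
`(δ¹f̂_{s,x}) ∪ (o_x^*κ)` has a bounded Γ-invariant primitive on the group `Γ`;
i.e. `[δ¹f̂_{s,x}] ∪ o_x^*[κ] = 0` in degree-(n+2) bounded cohomology of `Γ`. -/
theorem statement3 {V : Type*} (X : SimpleGraph V) (D σ : ℕ)
    (hmed : IsMedianGraph X) (hdim : DimLE X D) (hstair : StaircaseLE X σ)
    (Γ : Type*) [Group Γ] [MulAction Γ V] (hact : ActsOn Γ X)
    (l : ℕ) (hl : 1 ≤ l) (s : Fin l → Set V) (hseg : IsHSegment X l s)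
    (x : V) (n : ℕ) (hn : 1 ≤ n) (κ : (Fin (n + 1) → V) → ℝ)
    (hκb : IsBounded κ) (hκinv : IsInvariant Γ κ)
    (hκcoc : cob κ = 0)
    (hκnt : ∀ γ : Γ, NonTransverseTo X hl κ (segSMul γ s)) :
    ∃ β : (Fin (n + 2) → Γ) → ℝ, IsBounded β ∧ IsInvariant Γ β ∧
      ∀ g : Fin (n + 3) → Γ,
        cob β g =
          d1 (fun γ₀ γ₁ : Γ => fs X Γ s (γ₀ • x) (γ₁ • x)) (g 0) (g 1) (g 2) *
            κ (fun i => (g ⟨2 + (i : ℕ), by have := i.isLt; omega⟩) • x) := by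
  obtain ⟨k, rfl⟩ : ∃ k, n = k + 1 := ⟨n - 1, by omega⟩
  obtain ⟨β, ⟨C, hC⟩, hinv, hβ⟩ :=
    exists_bounded_invariant_primitive hmed hdim hstair hact hl hseg hκb hκinv hκcoc hκnt
  refine ⟨fun g => β fun i => g i • x, ⟨C, fun g => hC _⟩, fun γ g => ?_, fun g => ?_⟩
  · simpa only [smul_eq_mul, mul_smul] using hinv γ fun i => g i • x
  · refine (hβ fun i => g i • x).trans ?_
    congr 2
    funext i
    simp only [Fin.tail]
    congr 2
    ext
    simp only [Fin.val_succ]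
    omega

end MedianQM
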